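/- arXiv:1609.05644 — 4 statements merged into one kernel-verified Lean document; each statement's English description precedes it below -/
import Mathlib

section
/- Every X ∈ so(2,n) can be written uniquely as X = K + H + Z with K ∈ 𝔨, H ∈ 𝔞 and Z ∈ 𝔫; that is, so(2,n) = 𝔨 ⊕ 𝔞 ⊕ 𝔫 as a direct sum of ℝ-subspaces (the Iwasawa decomposition of so(2,n)). -/
open Matrix

noncomputable section

/-- Index type for `(n+2) × (n+2)` matrices, split as the first four coordinates plus
the remaining `n - 2` coordinates.  `Sum.inl 0, …, Sum.inl 3` are the coordinates
`1, …, 4` of the paper, and `Sum.inr j` is the coordinate `j + 5`. -/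
abbrev Idx (n : ℕ) := Fin 4 ⊕ Fin (n - 2)

/-- The matrix `ε = diag(−1,−1,1,…,1)`. -/
def eps (n : ℕ) : Matrix (Idx n) (Idx n) ℝ :=
  Matrix.fromBlocks (Matrix.diagonal ![-1, -1, 1, 1]) 0 0 1

/-- Whether an index is one of the first two coordinates. -/
def firstTwo (n : ℕ) (i : Idx n) : Prop := i = Sum.inl 0 ∨ i = Sum.inl 1

/-- `𝔨 ≅ so(2) ⊕ so(n)`: skew-symmetric matrices that are block diagonal with respect to the
splitting into the first two coordinates and the last `n` coordinates. -/
def kset (n : ℕ) : Set (Matrix (Idx n) (Idx n) ℝ) :=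
  {M | Mᵀ = -M ∧ ∀ i j : Idx n, (firstTwo n i ∧ ¬ firstTwo n j) ∨
    (¬ firstTwo n i ∧ firstTwo n j) → M i j = 0}

/-- The matrix `H_{a,b} ∈ 𝔞`. -/
def Hmat (n : ℕ) (a b : ℝ) : Matrix (Idx n) (Idx n) ℝ :=
  Matrix.fromBlocks !![0,0,a,0; 0,0,0,b; a,0,0,0; 0,b,0,0] 0 0 0

/-- The abelian part `𝔞 = {H_{a,b} : a, b ∈ ℝ}`. -/
def aset (n : ℕ) : Set (Matrix (Idx n) (Idx n) ℝ) :=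
  {M | ∃ a b : ℝ, M = Hmat n a b}

/-- The matrix `X(a,b,v,w) ∈ 𝔫`. -/
def Xmat (n : ℕ) (a b : ℝ) (v w : Fin (n - 2) → ℝ) : Matrix (Idx n) (Idx n) ℝ :=
  Matrix.fromBlocks
    !![0, b+a, 0, -b-a; -b-a, 0, -b+a, 0; 0, -b+a, 0, b-a; -b-a, 0, -b+a, 0]
    (Matrix.of fun i j => ![v j, w j, v j, w j] i)
    (Matrix.of fun j i => ![v j, w j, -v j, -w j] i)
    0

/-- The nilpotent part `𝔫 = {X(a,b,v,w) : a,b ∈ ℝ, v,w ∈ ℝ^{n−2}}`. -/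
def nset (n : ℕ) : Set (Matrix (Idx n) (Idx n) ℝ) :=
  {M | ∃ (a b : ℝ) (v w : Fin (n - 2) → ℝ), M = Xmat n a b v w}

theorem eps_eq_diagonal (n : ℕ) :
    eps n = Matrix.diagonal (Sum.elim ![-1, -1, 1, 1] fun _ => 1) := by
  rw [eps, ← Matrix.diagonal_one, Matrix.fromBlocks_diagonal]

/-- The entrywise form of the condition `Xᵀ ε + ε X = 0` defining `so(2,n)`. -/
theorem so_apply {n : ℕ} {X : Matrix (Idx n) (Idx n) ℝ}
    (hX : Xᵀ * eps n + eps n * X = 0) (i j : Idx n) :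
    X j i * Sum.elim ![-1, -1, 1, 1] (fun _ => 1) j +
      Sum.elim ![-1, -1, 1, 1] (fun _ => 1) i * X i j = 0 := by
  have h := congrFun (congrFun hX i) j
  rw [eps_eq_diagonal] at h
  simpa [Matrix.mul_diagonal, Matrix.diagonal_mul] using h

/-- The `𝔨`-component of `X ∈ so(2,n)`: subtracting the `𝔞`- and `𝔫`-components read off from
the upper right `2 × n` block of `X` leaves an element of `𝔨`. -/
theorem sub_Hmat_sub_Xmat_mem_kset {n : ℕ} {X : Matrix (Idx n) (Idx n) ℝ}
    (hX : Xᵀ * eps n + eps n * X = 0) :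
    X - Hmat n (X (Sum.inl 0) (Sum.inl 2)) (X (Sum.inl 1) (Sum.inl 3)) -
      Xmat n ((X (Sum.inl 1) (Sum.inl 2) - X (Sum.inl 0) (Sum.inl 3)) / 2)
        (-(X (Sum.inl 0) (Sum.inl 3) + X (Sum.inl 1) (Sum.inl 2)) / 2)
        (fun j => X (Sum.inl 0) (Sum.inr j)) (fun j => X (Sum.inl 1) (Sum.inr j)) ∈ kset n := by
  refine ⟨?_, ?_⟩
  · ext i j
    have h := so_apply hX i j
    have h02 := so_apply hX (Sum.inl 0) (Sum.inl 2)
    have h13 := so_apply hX (Sum.inl 1) (Sum.inl 3)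
    have h03 := so_apply hX (Sum.inl 0) (Sum.inl 3)
    have h12 := so_apply hX (Sum.inl 1) (Sum.inl 2)
    rcases i with i | i <;> rcases j with j | j
    · fin_cases i <;> fin_cases j <;> simp [Hmat, Xmat] at * <;> linarith
    · fin_cases i <;> simp [Hmat, Xmat] at * <;> linarith
    · fin_cases j <;> simp [Hmat, Xmat] at * <;> linarith
    · simp [Hmat, Xmat] at *; linarith
  · intro i j hij
    have h := so_apply hX i j
    rcases i with i | i <;> rcases j with j | j
    · fin_cases i <;> fin_cases j <;> simp [firstTwo, Hmat, Xmat] at * <;> linarith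
    · fin_cases i <;> simp [firstTwo, Hmat, Xmat] at *
    · fin_cases j <;> simp [firstTwo, Hmat, Xmat] at * <;> linarith
    · simp [firstTwo] at hij

/-- Iwasawa decomposition of `so(2,n)`: every `X ∈ so(2,n)` can be written uniquely as
`X = K + H + Z` with `K ∈ 𝔨`, `H ∈ 𝔞` and `Z ∈ 𝔫`. -/
theorem stmt_3 (n : ℕ) (hn : 3 ≤ n) (X : Matrix (Idx n) (Idx n) ℝ)
    (hX : Xᵀ * eps n + eps n * X = 0) :
    ∃! KHZ : Matrix (Idx n) (Idx n) ℝ × Matrix (Idx n) (Idx n) ℝ × Matrix (Idx n) (Idx n) ℝ,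
      KHZ.1 ∈ kset n ∧ KHZ.2.1 ∈ aset n ∧ KHZ.2.2 ∈ nset n ∧
      X = KHZ.1 + KHZ.2.1 + KHZ.2.2 := by
  have recompose (A B C : Matrix (Idx n) (Idx n) ℝ) : A = A - B - C + B + C := by abel
  refine ⟨(_, Hmat n _ _, Xmat n _ _ _ _), ⟨sub_Hmat_sub_Xmat_mem_kset hX,
    ⟨_, _, rfl⟩, ⟨_, _, _, _, rfl⟩, recompose _ _ _⟩, ?_⟩
  rintro ⟨K, H, Z⟩ ⟨hK, ⟨a, b, rfl⟩, ⟨c, d, v, w, rfl⟩, hsum⟩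
  dsimp only at hK hsum
  have entry (i j : Idx n) (hi : firstTwo n i) (hj : ¬ firstTwo n j) :
      X i j = Hmat n a b i j + Xmat n c d v w i j := by
    rw [hsum, Matrix.add_apply, Matrix.add_apply, hK.2 i j (Or.inl ⟨hi, hj⟩), zero_add]
  have h02 := entry (Sum.inl 0) (Sum.inl 2) (by simp [firstTwo]) (by simp [firstTwo])
  have h13 := entry (Sum.inl 1) (Sum.inl 3) (by simp [firstTwo]) (by simp [firstTwo])
  have h03 := entry (Sum.inl 0) (Sum.inl 3) (by simp [firstTwo]) (by simp [firstTwo])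
  have h12 := entry (Sum.inl 1) (Sum.inl 2) (by simp [firstTwo]) (by simp [firstTwo])
  have hv (j) := entry (Sum.inl 0) (Sum.inr j) (by simp [firstTwo]) (by simp [firstTwo])
  have hw (j) := entry (Sum.inl 1) (Sum.inr j) (by simp [firstTwo]) (by simp [firstTwo])
  simp [Hmat, Xmat] at h02 h13 h03 h12 hv hw
  have hc : (X (Sum.inl 1) (Sum.inl 2) - X (Sum.inl 0) (Sum.inl 3)) / 2 = c := by
    linarith
  have hd : -(X (Sum.inl 0) (Sum.inl 3) + X (Sum.inl 1) (Sum.inl 2)) / 2 = d := by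
    linarith
  simp only [hc, hd, h02, h13, hv, hw, Prod.mk.injEq, and_true]
  rw [hsum]
  abel
end
end

section
/- For every p ∈ AdS^{n+1}, the ℝ-linear subspace {X·p : X ∈ 𝔫} of ℝ^{n+2} has dimension n−1 if p₂ = p₄, and dimension n if p₂ ≠ p₄. -/
open Matrix

noncomputable section

/-- The scalar product `⟨x,y⟩ = −x₁y₁ − x₂y₂ + x₃y₃ + ⋯ + x_{n+2}y_{n+2}` of `ℝ^{2,n}`. -/
def ip (n : ℕ) (x y : Idx n → ℝ) : ℝ :=
  -(x (Sum.inl 0) * y (Sum.inl 0)) - x (Sum.inl 1) * y (Sum.inl 1)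
    + x (Sum.inl 2) * y (Sum.inl 2) + x (Sum.inl 3) * y (Sum.inl 3)
    + ∑ j, x (Sum.inr j) * y (Sum.inr j)

theorem Xmat_mulVec (n : ℕ) (a b : ℝ) (v w : Fin (n - 2) → ℝ) (p : Idx n → ℝ) :
    (Xmat n a b v w).mulVec p = Sum.elim
      ![(b + a) * (p (Sum.inl 1) - p (Sum.inl 3)) + v ⬝ᵥ (p ∘ Sum.inr),
        -(b + a) * p (Sum.inl 0) + (a - b) * p (Sum.inl 2) + w ⬝ᵥ (p ∘ Sum.inr),
        (a - b) * (p (Sum.inl 1) - p (Sum.inl 3)) + v ⬝ᵥ (p ∘ Sum.inr),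
        -(b + a) * p (Sum.inl 0) + (a - b) * p (Sum.inl 2) + w ⬝ᵥ (p ∘ Sum.inr)]
      ((p (Sum.inl 0) - p (Sum.inl 2)) • v + (p (Sum.inl 1) - p (Sum.inl 3)) • w) := by
  rw [Xmat, Matrix.fromBlocks_mulVec]
  congr 1
  · ext i
    fin_cases i <;> simp [Matrix.mulVec, dotProduct, Fin.sum_univ_four] <;> ring
  · ext j
    simp [Matrix.mulVec, dotProduct, Fin.sum_univ_four]
    ring

/-- A parametrization of `𝔫·p` for `p` with `p₂ = p₄`, where `d = p₁ - p₃` and `q` is the vector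
of the last `n - 2` coordinates of `p`. -/
def degenerateParam (n : ℕ) (d : ℝ) (q : Fin (n - 2) → ℝ) :
    ℝ × (Fin (n - 2) → ℝ) →ₗ[ℝ] (Idx n → ℝ) where
  toFun x := Sum.elim ![x.2 ⬝ᵥ q, x.1, x.2 ⬝ᵥ q, x.1] (d • x.2)
  map_add' x y := by
    ext (i | j)
    · fin_cases i <;> simp [add_dotProduct]
    · simp
  map_smul' r x := by
    ext (i | j)
    · fin_cases i <;> simp
    · simp [mul_left_comm]

theorem degenerateParam_injective (n : ℕ) {d : ℝ} (hd : d ≠ 0) (q : Fin (n - 2) → ℝ) :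
    Function.Injective (degenerateParam n d q) := by
  intro x y h
  refine Prod.ext (by simpa [degenerateParam] using congrFun h (Sum.inl 1)) (funext fun j ↦ ?_)
  simpa [degenerateParam, hd] using congrFun h (Sum.inr j)

/-- A parametrization of `𝔫·p` for `p` with `c = p₂ - p₄ ≠ 0`, by the first, third and last
`n - 2` coordinates; here `s = p₁`, `t = p₃` and `q` is the vector of the last `n - 2` coordinates
of `p`. -/
def genericParam (n : ℕ) (c s t : ℝ) (q : Fin (n - 2) → ℝ) :
    ℝ × ℝ × (Fin (n - 2) → ℝ) →ₗ[ℝ] (Idx n → ℝ) where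
  toFun x := Sum.elim ![x.1, (x.2.2 ⬝ᵥ q - x.1 * s + x.2.1 * t) / c, x.2.1,
    (x.2.2 ⬝ᵥ q - x.1 * s + x.2.1 * t) / c] x.2.2
  map_add' x y := by
    ext (i | j)
    · fin_cases i <;> simp [add_dotProduct] <;> ring
    · simp
  map_smul' r x := by
    ext (i | j)
    · fin_cases i <;> simp <;> ring
    · simp

theorem genericParam_injective (n : ℕ) (c s t : ℝ) (q : Fin (n - 2) → ℝ) :
    Function.Injective (genericParam n c s t q) := by
  intro x y h
  refine Prod.ext (by simpa [genericParam] using congrFun h (Sum.inl 0))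
    (Prod.ext (by simpa [genericParam] using congrFun h (Sum.inl 2)) (funext fun j ↦ ?_))
  simpa [genericParam] using congrFun h (Sum.inr j)

theorem sub_ne_zero_of_ip_self {n : ℕ} {p : Idx n → ℝ} (hp : ip n p p = -1)
    (h : p (Sum.inl 1) = p (Sum.inl 3)) : p (Sum.inl 0) - p (Sum.inl 2) ≠ 0 := by
  intro h0
  have hq : 0 ≤ ∑ j, p (Sum.inr j) * p (Sum.inr j) :=
    Finset.sum_nonneg fun j _ ↦ mul_self_nonneg _
  rw [ip, h, sub_eq_zero.mp h0] at hp
  linarith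

theorem orbit_eq_range_degenerateParam {n : ℕ} {p : Idx n → ℝ} (hp : ip n p p = -1)
    (h : p (Sum.inl 1) = p (Sum.inl 3)) :
    {y : Idx n → ℝ | ∃ (a b : ℝ) (v w : Fin (n - 2) → ℝ), y = (Xmat n a b v w).mulVec p} =
      LinearMap.range (degenerateParam n (p (Sum.inl 0) - p (Sum.inl 2)) (p ∘ Sum.inr)) := by
  have hd := sub_ne_zero_of_ip_self hp h
  ext y
  simp only [Set.mem_ofPred_eq, SetLike.mem_coe, LinearMap.mem_range, Xmat_mulVec, h]
  constructor
  · rintro ⟨a, b, v, w, rfl⟩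
    exact ⟨(-(b + a) * p (Sum.inl 0) + (a - b) * p (Sum.inl 2) + w ⬝ᵥ (p ∘ Sum.inr), v),
      by simp [degenerateParam]⟩
  · rintro ⟨⟨s, u⟩, rfl⟩
    refine ⟨-s / (p (Sum.inl 0) - p (Sum.inl 2)), 0, u, 0, ?_⟩
    have hs : s = -(0 + -s / (p (Sum.inl 0) - p (Sum.inl 2))) * p (Sum.inl 0) +
        (-s / (p (Sum.inl 0) - p (Sum.inl 2)) - 0) * p (Sum.inl 2) := by
      field_simp
      ring
    simp only [zero_dotProduct, add_zero, ← hs]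
    simp [degenerateParam]

theorem orbit_eq_range_genericParam {n : ℕ} {p : Idx n → ℝ}
    (h : p (Sum.inl 1) ≠ p (Sum.inl 3)) :
    {y : Idx n → ℝ | ∃ (a b : ℝ) (v w : Fin (n - 2) → ℝ), y = (Xmat n a b v w).mulVec p} =
      LinearMap.range (genericParam n (p (Sum.inl 1) - p (Sum.inl 3)) (p (Sum.inl 0))
        (p (Sum.inl 2)) (p ∘ Sum.inr)) := by
  have hc := sub_ne_zero.mpr h
  ext y
  simp only [Set.mem_ofPred_eq, SetLike.mem_coe, LinearMap.mem_range, Xmat_mulVec]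
  generalize p (Sum.inl 1) - p (Sum.inl 3) = c at hc ⊢
  constructor
  · rintro ⟨a, b, v, w, rfl⟩
    refine ⟨((b + a) * c + v ⬝ᵥ (p ∘ Sum.inr), (a - b) * c + v ⬝ᵥ (p ∘ Sum.inr),
      (p (Sum.inl 0) - p (Sum.inl 2)) • v + c • w), ?_⟩
    ext (i | j)
    · fin_cases i <;> simp [genericParam, add_dotProduct] <;> field_simp <;> ring
    · simp [genericParam]
  · rintro ⟨⟨r, s, u⟩, rfl⟩
    refine ⟨(r + s) / (2 * c), (r - s) / (2 * c), 0, c⁻¹ • u, ?_⟩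
    ext (i | j)
    · fin_cases i <;> simp [genericParam] <;> field_simp <;> ring
    · simp [genericParam, hc]

/-- The tangent space `𝔫·p = {X·p : X ∈ 𝔫}` of the `N`-orbit through `p ∈ AdS^{n+1}` has
dimension `n − 1` if `p₂ = p₄`, and dimension `n` if `p₂ ≠ p₄`. -/
theorem stmt_8 (n : ℕ) (hn : 3 ≤ n) (p : Idx n → ℝ) (hp : ip n p p = -1) :
    (p (Sum.inl 1) = p (Sum.inl 3) →
      Module.finrank ℝ (Submodule.span ℝ {y : Idx n → ℝ |
        ∃ (a b : ℝ) (v w : Fin (n - 2) → ℝ), y = (Xmat n a b v w).mulVec p}) = n - 1) ∧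
    (p (Sum.inl 1) ≠ p (Sum.inl 3) →
      Module.finrank ℝ (Submodule.span ℝ {y : Idx n → ℝ |
        ∃ (a b : ℝ) (v w : Fin (n - 2) → ℝ), y = (Xmat n a b v w).mulVec p}) = n) := by
  refine ⟨fun h ↦ ?_, fun h ↦ ?_⟩
  · rw [orbit_eq_range_degenerateParam hp h, Submodule.span_eq,
      LinearMap.finrank_range_of_inj
        (degenerateParam_injective n (sub_ne_zero_of_ip_self hp h) _)]
    simp
    omega
  · rw [orbit_eq_range_genericParam h, Submodule.span_eq,
      LinearMap.finrank_range_of_inj (genericParam_injective n _ _ _ _)]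
    simp
    omega
end
end

section
/- Let p ∈ AdS^{n+1} with p₂ = p₄. Then {X·p : X ∈ 𝔞 + 𝔫} = {X·p : X ∈ 𝔮_∅} = {X·p : X ∈ 𝔮₁} = {v ∈ ℝ^{n+2} : ⟨v,p⟩ = 0 and v₂ = v₄}. (Hence the minimal parabolic subgroup Q_∅, the parabolic subgroup Q₁ and the solvable Iwasawa group AN of SO⁰(2,n) induce the same orbit foliation on AdS^{n+1}; they act with cohomogeneity zero but are not transitive.) -/
open Matrix

noncomputable section

/-- `𝔨₀`: the elements of `so(2,n)` whose first four rows and columns vanish. -/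
def k0set (n : ℕ) : Set (Matrix (Idx n) (Idx n) ℝ) :=
  {M | Mᵀ * eps n + eps n * M = 0 ∧ (∀ (i : Fin 4) (j : Idx n), M (Sum.inl i) j = 0) ∧
    (∀ (i : Idx n) (j : Fin 4), M i (Sum.inl j) = 0)}

/-- The subalgebra `𝔞 + 𝔫`, as a set of matrices. -/
def anset (n : ℕ) : Set (Matrix (Idx n) (Idx n) ℝ) :=
  {M | ∃ (a' b' a b : ℝ) (v w : Fin (n - 2) → ℝ), M = Hmat n a' b' + Xmat n a b v w}

/-- The minimal parabolic subalgebra `𝔮_∅ = 𝔨₀ + 𝔞 + 𝔫`. -/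
def qemptyset (n : ℕ) : Set (Matrix (Idx n) (Idx n) ℝ) :=
  {M | ∃ K ∈ k0set n, ∃ N ∈ anset n, M = K + N}

/-- The parabolic subalgebra `𝔮₁ = 𝔮_∅ + g_{−α₂}`, where `g_{−α₂} = {X(0,0,v,0)ᵀ}`. -/
def q1set (n : ℕ) : Set (Matrix (Idx n) (Idx n) ℝ) :=
  {M | ∃ Q ∈ qemptyset n, ∃ v : Fin (n - 2) → ℝ, M = Q + (Xmat n 0 0 v 0)ᵀ}

theorem ip_eq_dotProduct (n : ℕ) (x y : Idx n → ℝ) : ip n x y = x ⬝ᵥ eps n *ᵥ y := by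
  simp [ip, eps, fromBlocks_mulVec, dotProduct, Fintype.sum_sum_type, Fin.sum_univ_four,
    mulVec_diagonal]
  ring

theorem ip_comm (n : ℕ) (x y : Idx n → ℝ) : ip n x y = ip n y x := by
  simp only [ip, mul_comm]

theorem ip_add_left (n : ℕ) (x y z : Idx n → ℝ) : ip n (x + y) z = ip n x z + ip n y z := by
  simp only [ip_eq_dotProduct, add_dotProduct]

/-- The right-hand side of the theorem: vectors `y` orthogonal to `p` with `y₂ = y₄`. -/
def leafTangent (n : ℕ) (p : Idx n → ℝ) : Set (Idx n → ℝ) :=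
  {y | ip n y p = 0 ∧ y (Sum.inl 1) = y (Sum.inl 3)}

theorem leafTangent_add {n : ℕ} {p x y : Idx n → ℝ} (hx : x ∈ leafTangent n p)
    (hy : y ∈ leafTangent n p) : x + y ∈ leafTangent n p := by
  refine ⟨?_, ?_⟩
  · rw [ip_add_left, hx.1, hy.1, add_zero]
  · simp only [Pi.add_apply, hx.2, hy.2]

theorem ip_mulVec_self_of_skew {n : ℕ} {M : Matrix (Idx n) (Idx n) ℝ}
    (hM : Mᵀ * eps n + eps n * M = 0) (p : Idx n → ℝ) : ip n (M *ᵥ p) p = 0 := by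
  have h₁ : ip n (M *ᵥ p) p = p ⬝ᵥ (Mᵀ * eps n) *ᵥ p := by
    rw [ip_eq_dotProduct, ← mulVec_mulVec, dotProduct_mulVec p, vecMul_transpose]
  have h₂ : ip n (M *ᵥ p) p = p ⬝ᵥ (eps n * M) *ᵥ p := by
    rw [ip_comm, ip_eq_dotProduct, mulVec_mulVec]
  have h₃ : p ⬝ᵥ (Mᵀ * eps n) *ᵥ p + p ⬝ᵥ (eps n * M) *ᵥ p = 0 := by
    rw [← dotProduct_add, ← add_mulVec, hM, zero_mulVec, dotProduct_zero]
  linarith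

theorem mulVec_mem_leafTangent_of_mem_k0set {n : ℕ} {M : Matrix (Idx n) (Idx n) ℝ}
    (hM : M ∈ k0set n) (p : Idx n → ℝ) : M *ᵥ p ∈ leafTangent n p := by
  refine ⟨ip_mulVec_self_of_skew hM.1 p, ?_⟩
  simp [mulVec, dotProduct, hM.2.1]

/-- The action of `𝔞 + 𝔫` on a vector with `p₂ = p₄`. -/
theorem Hmat_add_Xmat_mulVec {n : ℕ} {p : Idx n → ℝ} (hp24 : p (Sum.inl 1) = p (Sum.inl 3))
    (a' b' a b : ℝ) (v w : Fin (n - 2) → ℝ) :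
    (Hmat n a' b' + Xmat n a b v w) *ᵥ p =
      Sum.elim
        ![a' * p (Sum.inl 2) + ∑ j, v j * p (Sum.inr j),
          b' * p (Sum.inl 3) - (b + a) * p (Sum.inl 0) + (a - b) * p (Sum.inl 2)
            + ∑ j, w j * p (Sum.inr j),
          a' * p (Sum.inl 0) + ∑ j, v j * p (Sum.inr j),
          b' * p (Sum.inl 3) - (b + a) * p (Sum.inl 0) + (a - b) * p (Sum.inl 2)
            + ∑ j, w j * p (Sum.inr j)]
        (fun j => v j * (p (Sum.inl 0) - p (Sum.inl 2))) := by
  funext i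
  rcases i with i | j
  · fin_cases i <;>
      simp [Hmat, Xmat, mulVec, dotProduct, Fin.sum_univ_four, hp24] <;> ring
  · simp [Hmat, Xmat, mulVec, dotProduct, Fin.sum_univ_four, hp24]
    ring

theorem Xmat_transpose_mulVec {n : ℕ} (p : Idx n → ℝ) (v : Fin (n - 2) → ℝ) :
    (Xmat n 0 0 v 0)ᵀ *ᵥ p =
      Sum.elim ![∑ j, v j * p (Sum.inr j), 0, -∑ j, v j * p (Sum.inr j), 0]
        (fun j => v j * (p (Sum.inl 0) + p (Sum.inl 2))) := by
  funext i
  rcases i with i | j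
  · fin_cases i <;> simp [Xmat, mulVec, dotProduct, Fin.sum_univ_four]
  · simp [Xmat, mulVec, dotProduct, Fin.sum_univ_four]
    ring

theorem sum_mul_const_mul {ι : Type*} [Fintype ι] (v u : ι → ℝ) (c : ℝ) :
    ∑ j, v j * c * u j = c * ∑ j, v j * u j := by
  rw [Finset.mul_sum]
  exact Finset.sum_congr rfl fun j _ => by ring

theorem mulVec_mem_leafTangent_of_mem_anset {n : ℕ} {p : Idx n → ℝ}
    (hp24 : p (Sum.inl 1) = p (Sum.inl 3)) {M : Matrix (Idx n) (Idx n) ℝ} (hM : M ∈ anset n) :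
    M *ᵥ p ∈ leafTangent n p := by
  obtain ⟨a', b', a, b, v, w, rfl⟩ := hM
  rw [Hmat_add_Xmat_mulVec hp24]
  refine ⟨?_, by simp⟩
  simp [ip, sum_mul_const_mul, hp24]
  ring

theorem Xmat_transpose_mulVec_mem_leafTangent {n : ℕ} (p : Idx n → ℝ) (v : Fin (n - 2) → ℝ) :
    (Xmat n 0 0 v 0)ᵀ *ᵥ p ∈ leafTangent n p := by
  rw [Xmat_transpose_mulVec]
  refine ⟨?_, by simp⟩
  simp [ip, sum_mul_const_mul]
  ring

theorem exists_mem_anset_mulVec_eq {n : ℕ} {p : Idx n → ℝ} (hp : ip n p p = -1)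
    (hp24 : p (Sum.inl 1) = p (Sum.inl 3)) {y : Idx n → ℝ} (hy : y ∈ leafTangent n p) :
    ∃ M ∈ anset n, y = M *ᵥ p := by
  obtain ⟨hy, hy24⟩ := hy
  have hu : 0 ≤ ∑ j, p (Sum.inr j) * p (Sum.inr j) :=
    Finset.sum_nonneg fun j _ => mul_self_nonneg _
  simp only [ip, hp24] at hp
  have hne : p (Sum.inl 0) - p (Sum.inl 2) ≠ 0 := fun h => by
    rw [sub_eq_zero.mp h] at hp
    linarith
  have hp0 : p (Sum.inl 0) ≠ 0 := fun h => by
    rw [h] at hp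
    nlinarith [mul_self_nonneg (p (Sum.inl 2))]
  set c := p (Sum.inl 0) - p (Sum.inl 2) with hc
  have hsum : ∑ j, y (Sum.inr j) / c * p (Sum.inr j)
      = (y (Sum.inl 0) * p (Sum.inl 0) - y (Sum.inl 2) * p (Sum.inl 2)) / c := by
    have h : ∑ j, y (Sum.inr j) * p (Sum.inr j)
        = y (Sum.inl 0) * p (Sum.inl 0) - y (Sum.inl 2) * p (Sum.inl 2) := by
      simp only [ip, hp24, hy24] at hy
      linarith
    rw [← h, Finset.sum_div]
    exact Finset.sum_congr rfl fun j _ => by ring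
  refine ⟨_, ⟨(y (Sum.inl 2) - y (Sum.inl 0)) / c, 0, -y (Sum.inl 3) / (2 * p (Sum.inl 0)),
    -y (Sum.inl 3) / (2 * p (Sum.inl 0)), fun j => y (Sum.inr j) / c, 0, rfl⟩, ?_⟩
  rw [Hmat_add_Xmat_mulVec hp24, hsum, ← hc]
  funext i
  rcases i with i | j
  · fin_cases i <;> simp [hy24] <;> field_simp
    · linear_combination y (Sum.inl 0) * hc
    · ring
    · linear_combination y (Sum.inl 2) * hc
    · ring
  · simp [hne]

theorem anset_subset_qemptyset (n : ℕ) : anset n ⊆ qemptyset n := fun M hM =>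
  ⟨0, by simp [k0set], M, hM, (zero_add M).symm⟩

theorem qemptyset_subset_q1set (n : ℕ) : qemptyset n ⊆ q1set n := fun M hM =>
  ⟨M, hM, 0, by
    have h : Xmat n 0 0 0 0 = 0 := by
      ext i j
      rcases i with i | i <;> rcases j with j | j
      · fin_cases i <;> fin_cases j <;> simp [Xmat]
      · fin_cases i <;> simp [Xmat]
      · fin_cases j <;> simp [Xmat]
      · simp [Xmat]
    rw [h, transpose_zero, add_zero]⟩

theorem mulVec_mem_leafTangent_of_mem_qemptyset {n : ℕ} {p : Idx n → ℝ}
    (hp24 : p (Sum.inl 1) = p (Sum.inl 3)) {M : Matrix (Idx n) (Idx n) ℝ}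
    (hM : M ∈ qemptyset n) : M *ᵥ p ∈ leafTangent n p := by
  obtain ⟨K, hK, N, hN, rfl⟩ := hM
  rw [add_mulVec]
  exact leafTangent_add (mulVec_mem_leafTangent_of_mem_k0set hK p)
    (mulVec_mem_leafTangent_of_mem_anset hp24 hN)

theorem mulVec_mem_leafTangent_of_mem_q1set {n : ℕ} {p : Idx n → ℝ}
    (hp24 : p (Sum.inl 1) = p (Sum.inl 3)) {M : Matrix (Idx n) (Idx n) ℝ}
    (hM : M ∈ q1set n) : M *ᵥ p ∈ leafTangent n p := by
  obtain ⟨Q, hQ, v, rfl⟩ := hM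
  rw [add_mulVec]
  exact leafTangent_add (mulVec_mem_leafTangent_of_mem_qemptyset hp24 hQ)
    (Xmat_transpose_mulVec_mem_leafTangent p v)

/-- If `p ∈ AdS^{n+1}` has `p₂ = p₄`, then
`(𝔞 + 𝔫)·p = 𝔮_∅·p = 𝔮₁·p = {v : ⟨v,p⟩ = 0 and v₂ = v₄}`: the groups `AN`, `Q_∅` and `Q₁`
induce the same (non-transitive, cohomogeneity zero) orbit foliation on `AdS^{n+1}`. -/
theorem stmt_11 (n : ℕ) (hn : 3 ≤ n) (p : Idx n → ℝ) (hp : ip n p p = -1)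
    (hp24 : p (Sum.inl 1) = p (Sum.inl 3)) :
    ({y : Idx n → ℝ | ∃ M ∈ anset n, y = M.mulVec p}
      = {v : Idx n → ℝ | ip n v p = 0 ∧ v (Sum.inl 1) = v (Sum.inl 3)}) ∧
    ({y : Idx n → ℝ | ∃ M ∈ qemptyset n, y = M.mulVec p}
      = {v : Idx n → ℝ | ip n v p = 0 ∧ v (Sum.inl 1) = v (Sum.inl 3)}) ∧
    ({y : Idx n → ℝ | ∃ M ∈ q1set n, y = M.mulVec p}
      = {v : Idx n → ℝ | ip n v p = 0 ∧ v (Sum.inl 1) = v (Sum.inl 3)}) := by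
  refine ⟨Set.Subset.antisymm ?_ ?_, Set.Subset.antisymm ?_ ?_, Set.Subset.antisymm ?_ ?_⟩
  · rintro _ ⟨M, hM, rfl⟩
    exact mulVec_mem_leafTangent_of_mem_anset hp24 hM
  · exact fun y hy => exists_mem_anset_mulVec_eq hp hp24 hy
  · rintro _ ⟨M, hM, rfl⟩
    exact mulVec_mem_leafTangent_of_mem_qemptyset hp24 hM
  · intro y hy
    obtain ⟨M, hM, h⟩ := exists_mem_anset_mulVec_eq hp hp24 hy
    exact ⟨M, anset_subset_qemptyset n hM, h⟩
  · rintro _ ⟨M, hM, rfl⟩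
    exact mulVec_mem_leafTangent_of_mem_q1set hp24 hM
  · intro y hy
    obtain ⟨M, hM, h⟩ := exists_mem_anset_mulVec_eq hp hp24 hy
    exact ⟨M, qemptyset_subset_q1set n (anset_subset_qemptyset n hM), h⟩
end
end

section
/- Let c ∈ ℝ, let X ∈ M_{n−1}(ℂ) satisfy X* = −X and tr X = −2ic, and let ξ be the complex (n+1)×(n+1) matrix in block form (block sizes 1, 1, n−1) with block rows (ic, 1, 0), (1, ic, 0), (0, 0, X). Let 𝔣₀ be any ℝ-linear subspace of {blockdiag(0, 0, Y) : Y ∈ M_{n−1}(ℂ), Y* = −Y, tr Y = 0}, and set 𝔣 = ℝξ + 𝔣₀. Then for every p ∈ AdS^{2n+1}: {Z·p : Z ∈ 𝔣 + 𝔫} = {Z·p : Z ∈ ℝX_c + 𝔫} as subsets of ℂ^{n+1}. (Hence the cohomogeneity one actions of the groups FN and F_cN on AdS^{2n+1} are orbit equivalent.) -/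
open Matrix Complex

noncomputable section

/-- Index type for `ℂ^{1,n} = ℂ^{n+1}`, in block form with block sizes `1, 1, n−1`. -/
abbrev Kdx (n : ℕ) := Fin 2 ⊕ Fin (n - 1)

/-- The real scalar product `⟨z,w⟩ = Re(−z₀w̄₀ + Σ_{k=1}^{n} z_k w̄_k)` on `ℂ^{1,n}`. -/
def ipC (n : ℕ) (z w : Kdx n → ℂ) : ℝ :=
  (-(z (Sum.inl 0) * (starRingEnd ℂ) (w (Sum.inl 0)))
    + z (Sum.inl 1) * (starRingEnd ℂ) (w (Sum.inl 1))
    + ∑ k, z (Sum.inr k) * (starRingEnd ℂ) (w (Sum.inr k))).re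

/-- The matrix `N(μ,v) ∈ 𝔫 ⊆ su(1,n)` with block rows `(iμ, −iμ, v*)`, `(iμ, −iμ, v*)`,
`(v, −v, 0)`. -/
def Nmat (n : ℕ) (μ : ℝ) (v : Fin (n - 1) → ℂ) : Matrix (Kdx n) (Kdx n) ℂ :=
  Matrix.fromBlocks
    !![I * μ, -(I * μ); I * μ, -(I * μ)]
    (Matrix.of fun _ k => (starRingEnd ℂ) (v k))
    (Matrix.of fun k i => ![v k, -v k] i)
    0

/-- The matrix `ξ` with block rows `(ic, 1, 0)`, `(1, ic, 0)`, `(0, 0, X)`. -/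
def ximat (n : ℕ) (c : ℝ) (X : Matrix (Fin (n - 1)) (Fin (n - 1)) ℂ) :
    Matrix (Kdx n) (Kdx n) ℂ :=
  Matrix.fromBlocks !![I * c, 1; 1, I * c] 0 0 X

/-- The matrix `X_c` with block rows `(ic, 1, 0)`, `(1, ic, 0)`, `(0, 0, 0)`. -/
def Xc (n : ℕ) (c : ℝ) : Matrix (Kdx n) (Kdx n) ℂ :=
  Matrix.fromBlocks !![I * c, 1; 1, I * c] 0 0 0

lemma Nmat_mulVec_inl (n : ℕ) (μ : ℝ) (v : Fin (n - 1) → ℂ) (p : Kdx n → ℂ) (i : Fin 2) :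
    (Nmat n μ v).mulVec p (Sum.inl i) =
      I * μ * (p (Sum.inl 0) - p (Sum.inl 1)) + star v ⬝ᵥ (p ∘ Sum.inr) := by
  fin_cases i <;>
    simp [Nmat, Matrix.mulVec, dotProduct, Fintype.sum_sum_type, Fin.sum_univ_two] <;> ring

lemma Nmat_mulVec_inr (n : ℕ) (μ : ℝ) (v : Fin (n - 1) → ℂ) (p : Kdx n → ℂ)
    (k : Fin (n - 1)) :
    (Nmat n μ v).mulVec p (Sum.inr k) = (p (Sum.inl 0) - p (Sum.inl 1)) * v k := by
  simp [Nmat, Matrix.mulVec, dotProduct, Fintype.sum_sum_type, Fin.sum_univ_two]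
  ring

lemma ximat_eq_Xc_add (n : ℕ) (c : ℝ) (X : Matrix (Fin (n - 1)) (Fin (n - 1)) ℂ) :
    ximat n c X = Xc n c + Matrix.fromBlocks 0 0 0 X := by
  simp [ximat, Xc, Matrix.fromBlocks_add]

/-- A point of anti-de Sitter space does not lie on the complex hyperplane `z₀ = z₁`. -/
lemma sub_ne_zero_of_ipC_self (n : ℕ) (p : Kdx n → ℂ) (hp : ipC n p p = -1) :
    p (Sum.inl 0) - p (Sum.inl 1) ≠ 0 := by
  intro h
  rw [sub_eq_zero] at h
  have hnonneg : 0 ≤ ∑ k : Fin (n - 1), Complex.normSq (p (Sum.inr k)) :=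
    Finset.sum_nonneg fun k _ => Complex.normSq_nonneg _
  simp only [ipC, h, neg_add_cancel, zero_add, Complex.mul_conj, Complex.re_sum,
    Complex.ofReal_re] at hp
  linarith

/-- At a point with `z₀ ≠ z₁`, the directions in `𝔫` absorb every skew-Hermitian matrix acting on
the last block. -/
lemma exists_Nmat_mulVec_eq (n : ℕ) (A : Matrix (Fin (n - 1)) (Fin (n - 1)) ℂ) (hA : Aᴴ = -A)
    (p : Kdx n → ℂ) (hd : p (Sum.inl 0) - p (Sum.inl 1) ≠ 0)
    (μ : ℝ) (v : Fin (n - 1) → ℂ) :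
    ∃ (μ' : ℝ) (v' : Fin (n - 1) → ℂ),
      (Matrix.fromBlocks 0 0 0 A : Matrix (Kdx n) (Kdx n) ℂ).mulVec p + (Nmat n μ v).mulVec p
        = (Nmat n μ' v').mulVec p := by
  set d := p (Sum.inl 0) - p (Sum.inl 1) with hd_def
  set w : Fin (n - 1) → ℂ := p ∘ Sum.inr with hw
  set z : ℂ := star w ⬝ᵥ A.mulVec w with hz
  have hdual : star (A.mulVec w) ⬝ᵥ w = -z := by
    rw [Matrix.star_mulVec, hA, ← Matrix.dotProduct_mulVec, Matrix.neg_mulVec, dotProduct_neg]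
  have hstar : (starRingEnd ℂ) z = -z := by
    rw [← hdual, hz, starRingEnd_apply, ← Matrix.star_dotProduct_star, star_star]
  have hz_im : z = I * (z.im : ℂ) := by
    have hre := congrArg Complex.re hstar
    simp only [Complex.conj_re, Complex.neg_re] at hre
    apply Complex.ext
    · simp
      linarith
    · simp
  have hdc : (starRingEnd ℂ) d ≠ 0 := (map_ne_zero _).mpr hd
  refine ⟨μ + z.im / Complex.normSq d, v + d⁻¹ • A.mulVec w, ?_⟩
  funext i
  rcases i with i | k
  · rw [Pi.add_apply, Nmat_mulVec_inl, Nmat_mulVec_inl, Matrix.fromBlocks_mulVec]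
    simp only [Sum.elim_inl, Matrix.zero_mulVec, ← hw, ← hd_def, star_add, star_smul,
      add_dotProduct, smul_dotProduct, hdual, smul_eq_mul, Complex.ofReal_add,
      Complex.ofReal_div, ← Complex.mul_conj, star_inv₀, add_zero, Pi.zero_apply, zero_add]
    rw [← starRingEnd_apply]
    rw [hz_im]
    simp
    field_simp
    ring
  · rw [Pi.add_apply, Nmat_mulVec_inr, Nmat_mulVec_inr, Matrix.fromBlocks_mulVec]
    simp only [Sum.elim_inr, Matrix.zero_mulVec, ← hw, ← hd_def, zero_add, Pi.add_apply,
      Pi.smul_apply, smul_eq_mul]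
    field_simp
    ring

/-- The actions of `FN` (with `𝔣 = ℝξ + 𝔣₀`) and of `F_cN` on `AdS^{2n+1}` are orbit
equivalent: for every `p ∈ AdS^{2n+1}`, `(𝔣 + 𝔫)·p = (ℝX_c + 𝔫)·p`. -/
theorem stmt_18 (n : ℕ) (hn : 2 ≤ n) (c : ℝ)
    (X : Matrix (Fin (n - 1)) (Fin (n - 1)) ℂ) (hX : Xᴴ = -X)
    (htr : X.trace = -(2 * I * c))
    (F0 : Submodule ℝ (Matrix (Kdx n) (Kdx n) ℂ))
    (hF0 : ∀ F ∈ F0, ∃ Y : Matrix (Fin (n - 1)) (Fin (n - 1)) ℂ,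
      Yᴴ = -Y ∧ Y.trace = 0 ∧ F = Matrix.fromBlocks 0 0 0 Y)
    (p : Kdx n → ℂ) (hp : ipC n p p = -1) :
    {y : Kdx n → ℂ | ∃ (t : ℝ) (F : Matrix (Kdx n) (Kdx n) ℂ), F ∈ F0 ∧
        ∃ (μ : ℝ) (v : Fin (n - 1) → ℂ),
          y = (t • ximat n c X + F + Nmat n μ v).mulVec p}
      = {y : Kdx n → ℂ | ∃ (t : ℝ) (μ : ℝ) (v : Fin (n - 1) → ℂ),
          y = (t • Xc n c + Nmat n μ v).mulVec p} := by
  have hd := sub_ne_zero_of_ipC_self n p hp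
  ext y
  simp only [Set.mem_ofPred_eq]
  constructor
  · rintro ⟨t, F, hF, μ, v, rfl⟩
    obtain ⟨Y, hY, -, rfl⟩ := hF0 F hF
    obtain ⟨μ', v', h⟩ := exists_Nmat_mulVec_eq n (t • X + Y)
      (by rw [conjTranspose_add, conjTranspose_smul, hX, hY, star_trivial, smul_neg, neg_add])
      p hd μ v
    refine ⟨t, μ', v', ?_⟩
    have hB : t • ximat n c X + Matrix.fromBlocks 0 0 0 Y
        = t • Xc n c + Matrix.fromBlocks 0 0 0 (t • X + Y) := by
      rw [ximat_eq_Xc_add, smul_add, add_assoc, Matrix.fromBlocks_smul, Matrix.fromBlocks_add]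
      simp
    rw [hB, Matrix.add_mulVec, Matrix.add_mulVec, Matrix.add_mulVec, ← h, add_assoc]
  · rintro ⟨t, μ, v, rfl⟩
    obtain ⟨μ', v', h⟩ := exists_Nmat_mulVec_eq n (-(t • X))
      (by rw [conjTranspose_neg, conjTranspose_smul, hX, star_trivial, smul_neg]) p hd μ v
    refine ⟨t, 0, F0.zero_mem, μ', v', ?_⟩
    have hB : t • ximat n c X + Matrix.fromBlocks 0 0 0 (-(t • X)) = t • Xc n c := by
      rw [ximat_eq_Xc_add, smul_add, add_assoc, Matrix.fromBlocks_smul, Matrix.fromBlocks_add]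
      simp
    rw [add_zero, Matrix.add_mulVec, Matrix.add_mulVec, ← h, ← hB, Matrix.add_mulVec, add_assoc]
end
end
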